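/- Let X be a finite nonempty set, let x : ℕ → X be a sequence with visit counts N_t(y) = #{k < t : x_k = y}, let T ≥ 1 be a natural number, and let ε ≥ 0, c ≥ 0, E ≥ 0. Suppose gap : ℕ → ℝ and e : ℕ → ℝ satisfy, for all t < T: 0 ≤ gap_t, e_t ≥ 0, gap_t ≤ 2·ε + c·( e_t + 1/√(N_t(x_t) + 1) ), and Σ_{t=0}^{T−1} e_t ≤ E. Then Σ_{t=0}^{T−1} gap_t ≤ 2·ε·T + c·E + 2·c·√(|X| · T). -/

import Mathlib

open Finset

/-- Visit count: the number of indices `k < t` with `x k = y`. -/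
def visitCount {X : Type*} [DecidableEq X] (x : ℕ → X) (t : ℕ) (y : X) : ℕ :=
  ((Finset.range t).filter (fun k => x k = y)).card

theorem visitCount_succ {X : Type*} [DecidableEq X] (x : ℕ → X) (t : ℕ) (y : X) :
    visitCount x (t + 1) y = visitCount x t y + if y = x t then 1 else 0 := by
  by_cases h : y = x t
  · simp [visitCount, Finset.range_add_one, Finset.filter_insert, h]
  · simp [visitCount, Finset.range_add_one, Finset.filter_insert, h, Ne.symm h]

theorem sum_visitCount {X : Type*} [Fintype X] [DecidableEq X] (x : ℕ → X) (t : ℕ) :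
    ∑ y, visitCount x t y = t := by
  simpa [visitCount] using
    (Finset.card_eq_sum_card_fiberwise (s := Finset.range t) (t := Finset.univ) (f := x)
      (by simp)).symm

theorem one_div_sqrt_add_one_le {a : ℝ} (ha : 0 ≤ a) :
    1 / √(a + 1) ≤ 2 * √(a + 1) - 2 * √a := by
  have hpos : 0 < √(a + 1) := Real.sqrt_pos.2 (by linarith)
  rw [div_le_iff₀ hpos]
  nlinarith [Real.sq_sqrt ha, Real.sq_sqrt (show 0 ≤ a + 1 by linarith),
    sq_nonneg (√(a + 1) - √a)]

theorem sum_one_div_sqrt_visitCount_le_sum_sqrt {X : Type*} [Fintype X] [DecidableEq X]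
    (x : ℕ → X) (T : ℕ) :
    ∑ t ∈ Finset.range T, 1 / √((visitCount x t (x t) : ℝ) + 1) ≤
      ∑ y, 2 * √(visitCount x T y : ℝ) := by
  induction T with
  | zero => simp [visitCount]
  | succ T ih =>
    have hstep : ∑ y, 2 * √(visitCount x (T + 1) y : ℝ) = ∑ y, 2 * √(visitCount x T y : ℝ) +
        (2 * √((visitCount x T (x T) : ℝ) + 1) - 2 * √(visitCount x T (x T) : ℝ)) := by
      rw [← sub_eq_iff_eq_add', ← Finset.sum_sub_distrib, Finset.sum_eq_single (x T)]
      · simp [visitCount_succ]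
      · intro y _ hy
        simp [visitCount_succ, hy]
      · simp
    rw [Finset.sum_range_succ, hstep]
    exact add_le_add ih (one_div_sqrt_add_one_le (Nat.cast_nonneg _))

/-- Pigeonhole bound for the visit-count confidence terms. -/
theorem sum_one_div_sqrt_visitCount_le {X : Type*} [Fintype X] [DecidableEq X]
    (x : ℕ → X) (T : ℕ) :
    ∑ t ∈ Finset.range T, 1 / √((visitCount x t (x t) : ℝ) + 1) ≤
      2 * √((Fintype.card X : ℝ) * T) := by
  refine (sum_one_div_sqrt_visitCount_le_sum_sqrt x T).trans ?_
  rw [← Finset.mul_sum]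
  gcongr
  refine Real.le_sqrt_of_sq_le (sq_sum_le_card_mul_sum_sq.trans_eq ?_)
  simp only [Real.sq_sqrt (Nat.cast_nonneg _), ← Nat.cast_sum, sum_visitCount, Finset.card_univ]

/-- Deterministic skeleton of the TEQL regret bound: per-step gaps bounded by
approximation error, model-change terms and visit-count confidence terms sum to
`2εT + cE + 2c√(|X|T)`. -/
theorem teql_regret_skeleton
    {X : Type*} [Fintype X] [DecidableEq X] [Nonempty X]
    (x : ℕ → X) (T : ℕ) (hT : 1 ≤ T)
    (ε c E : ℝ) (hε : 0 ≤ ε) (hc : 0 ≤ c) (hE : 0 ≤ E)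
    (gap e : ℕ → ℝ)
    (hgap0 : ∀ t < T, 0 ≤ gap t) (he0 : ∀ t < T, 0 ≤ e t)
    (hgap : ∀ t < T, gap t ≤
      2 * ε + c * (e t + 1 / Real.sqrt ((visitCount x t (x t) : ℝ) + 1)))
    (hesum : ∑ t ∈ Finset.range T, e t ≤ E) :
    ∑ t ∈ Finset.range T, gap t ≤
      2 * ε * T + c * E + 2 * c * Real.sqrt ((Fintype.card X : ℝ) * T) := by
  calc ∑ t ∈ Finset.range T, gap t
      ≤ ∑ t ∈ Finset.range T, (2 * ε + c * (e t + 1 / √((visitCount x t (x t) : ℝ) + 1))) :=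
        Finset.sum_le_sum fun t ht => hgap t (Finset.mem_range.1 ht)
    _ = 2 * ε * T + c * (∑ t ∈ Finset.range T, e t) +
          c * ∑ t ∈ Finset.range T, 1 / √((visitCount x t (x t) : ℝ) + 1) := by
        simp only [Finset.sum_add_distrib, ← Finset.mul_sum, Finset.sum_const,
          Finset.card_range, nsmul_eq_mul]
        ring
    _ ≤ 2 * ε * T + c * E + c * (2 * √((Fintype.card X : ℝ) * T)) := by
        gcongr
        exact sum_one_div_sqrt_visitCount_le x T
    _ = 2 * ε * T + c * E + 2 * c * √((Fintype.card X : ℝ) * T) := by ring
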